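/- arXiv:2012.02188 — 2 statements merged into one kernel-verified Lean document; each statement's English description precedes it below -/
import Mathlib

section
/- Let α, C, λmin, λmax, R > 0 with λmax ≥ λmin, let n, K be natural numbers with n + 1 ≤ K, and assume α ≤ λmin / ((λmax² + 2·C·d·R)·K²). Let r', r, p', p ∈ ℝ^d with r' ≠ 0, ‖r‖ ≤ R, ‖r'‖ ≤ R, and let H', H be d×d real matrices. Assume: r = r' − α·H'·p'; p = r + (‖r‖²/‖r'‖²)·p'; ⟨x, H x⟩ ≥ λmin‖x‖² for all x ∈ ℝ^d; ‖H'‖ ≤ λmax and ‖H‖ ≤ λmax (spectral norms); ⟨r', H' p'⟩ ≥ λmin·‖r'‖²; ‖p'‖ ≤ n·‖r'‖; ‖p‖ ≤ (n+1)·‖r‖; and ‖H − H'‖ ≤ C·d·α·(‖p‖ + ‖p'‖). Then ⟨r, H p⟩ ≥ λmin·‖r‖². -/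
open scoped RealInnerProductSpace

/-- The spectral norm (operator norm induced by the Euclidean vector norms) of a real
rectangular matrix. -/
noncomputable def specNorm {m n : ℕ} (M : Matrix (Fin m) (Fin n) ℝ) : ℝ :=
  ‖LinearMap.toContinuousLinearMap (Matrix.toEuclideanLin M)‖

theorem norm_toEuclideanLin_le {m n : ℕ} (M : Matrix (Fin m) (Fin n) ℝ)
    (x : EuclideanSpace ℝ (Fin n)) : ‖Matrix.toEuclideanLin M x‖ ≤ specNorm M * ‖x‖ :=
  (LinearMap.toContinuousLinearMap (Matrix.toEuclideanLin M)).le_opNorm x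

/-- one-step propagation of the lower bound on `⟨r, H p⟩` for the FRGD
induction, under the step-size restriction `α ≤ λmin/((λmax² + 2·C·d·R)·K²)`. -/
theorem inner_r_Hp_ge {d : ℕ} (α C lmin lmax R : ℝ) (n K : ℕ)
    (hα : 0 < α) (hC : 0 < C) (hlmin : 0 < lmin) (hlmax : lmin ≤ lmax) (hR : 0 < R)
    (hnK : n + 1 ≤ K)
    (hstep : α ≤ lmin / ((lmax ^ 2 + 2 * C * d * R) * K ^ 2))
    (r' r p' p : EuclideanSpace ℝ (Fin d)) (hr' : r' ≠ 0)
    (hrR : ‖r‖ ≤ R) (hr'R : ‖r'‖ ≤ R)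
    (H' H : Matrix (Fin d) (Fin d) ℝ)
    (hrec : r = r' - α • Matrix.toEuclideanLin H' p')
    (hprec : p = r + (‖r‖ ^ 2 / ‖r'‖ ^ 2) • p')
    (hHpos : ∀ x : EuclideanSpace ℝ (Fin d), lmin * ‖x‖ ^ 2 ≤ ⟪x, Matrix.toEuclideanLin H x⟫)
    (hH'norm : specNorm H' ≤ lmax) (hHnorm : specNorm H ≤ lmax)
    (hip : lmin * ‖r'‖ ^ 2 ≤ ⟪r', Matrix.toEuclideanLin H' p'⟫)
    (hp' : ‖p'‖ ≤ n * ‖r'‖) (hp : ‖p‖ ≤ (n + 1) * ‖r‖)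
    (hdiff : specNorm (H - H') ≤ C * d * α * (‖p‖ + ‖p'‖)) :
    lmin * ‖r‖ ^ 2 ≤ ⟪r, Matrix.toEuclideanLin H p⟫ := by
  have hlmax0 : 0 < lmax := hlmin.trans_le hlmax
  have hCd : 0 ≤ C * d := by positivity
  have hK : (n : ℝ) + 1 ≤ K := by exact_mod_cast hnK
  have hn : (0 : ℝ) ≤ n := n.cast_nonneg
  have hK0 : (0 : ℝ) < K := by linarith
  have hαle : α * ((lmax ^ 2 + 2 * C * d * R) * K ^ 2) ≤ lmin :=
    (le_div_iff₀ (by positivity)).mp hstep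
  have hr'pos : 0 < ‖r'‖ := norm_pos_iff.mpr hr'
  set q := Matrix.toEuclideanLin H' p' with hq
  have hqnorm : ‖q‖ ≤ lmax * (n * ‖r'‖) :=
    (norm_toEuclideanLin_le H' p').trans (mul_le_mul hH'norm hp' (norm_nonneg _) hlmax0.le)
  have hqsq : ‖q‖ ^ 2 ≤ lmax ^ 2 * n ^ 2 * ‖r'‖ ^ 2 := by
    calc ‖q‖ ^ 2 ≤ (lmax * (n * ‖r'‖)) ^ 2 := by gcongr
      _ = _ := by ring
  have hnK2 : (n : ℝ) ^ 2 ≤ K ^ 2 := by gcongr; linarith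
  have hqα : α * ‖q‖ ^ 2 ≤ α * (lmax ^ 2 * K ^ 2) * ‖r'‖ ^ 2 := by
    calc α * ‖q‖ ^ 2 ≤ α * (lmax ^ 2 * n ^ 2 * ‖r'‖ ^ 2) := by gcongr
      _ ≤ α * (lmax ^ 2 * K ^ 2 * ‖r'‖ ^ 2) := by gcongr
      _ = _ := by ring
  have hαlmax : α * (lmax ^ 2 * K ^ 2) ≤ lmin := by
    have : 0 ≤ α * (2 * C * d * R * K ^ 2) := by positivity
    linarith
  have hαq : α * ‖q‖ ^ 2 ≤ lmin * ‖r'‖ ^ 2 := hqα.trans (by gcongr)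
  have hle : ‖r‖ ≤ ‖r'‖ := by
    refine le_of_sq_le_sq ?_ hr'pos.le
    have hexp : ‖r‖ ^ 2 = ‖r'‖ ^ 2 - α * (2 * ⟪r', q⟫ - α * ‖q‖ ^ 2) := by
      rw [hrec, norm_sub_sq_real, inner_smul_right, norm_smul, Real.norm_of_nonneg hα.le]
      ring
    have hnonneg : 0 ≤ 2 * ⟪r', q⟫ - α * ‖q‖ ^ 2 := by
      have : 0 ≤ lmin * ‖r'‖ ^ 2 := by positivity
      linarith
    have := mul_nonneg hα.le hnonneg
    linarith
  have hrq : lmin * ‖r'‖ ^ 2 - α * (lmax ^ 2 * K ^ 2) * ‖r'‖ ^ 2 ≤ ⟪r, q⟫ := by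
    have : ⟪r, q⟫ = ⟪r', q⟫ - α * ‖q‖ ^ 2 := by
      conv_lhs => rw [hrec]
      rw [inner_sub_left, inner_smul_left, real_inner_self_eq_norm_sq]
      simp
    linarith
  have hsum : ‖p‖ + ‖p'‖ ≤ 2 * K * ‖r'‖ := by
    calc ‖p‖ + ‖p'‖ ≤ (n + 1) * ‖r‖ + n * ‖r'‖ := add_le_add hp hp'
      _ ≤ K * ‖r'‖ + K * ‖r'‖ := by gcongr; linarith
      _ = _ := by ring
  have hdiffp : -(α * (2 * C * d * R * K ^ 2) * ‖r'‖ ^ 2)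
      ≤ ⟪r, Matrix.toEuclideanLin (H - H') p'⟫ := by
    refine neg_le_of_abs_le ((abs_real_inner_le_norm _ _).trans ?_)
    calc ‖r‖ * ‖Matrix.toEuclideanLin (H - H') p'‖
        ≤ R * (C * d * α * (2 * K * ‖r'‖) * (K * ‖r'‖)) := by
          refine mul_le_mul hrR ((norm_toEuclideanLin_le _ _).trans ?_) (norm_nonneg _) hR.le
          refine mul_le_mul (hdiff.trans (by gcongr)) (hp'.trans ?_) (norm_nonneg _)
            (by positivity)
          gcongr
          linarith
      _ = _ := by ring
  have hcross : 0 ≤ ⟪r, Matrix.toEuclideanLin H p'⟫ := by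
    have hsplit : Matrix.toEuclideanLin H p' = q + Matrix.toEuclideanLin (H - H') p' := by
      simp [hq]
    rw [hsplit, inner_add_right]
    have := mul_le_mul_of_nonneg_right hαle (sq_nonneg ‖r'‖)
    linarith
  rw [hprec, map_add, map_smul, inner_add_right, inner_smul_right]
  have : 0 ≤ ‖r‖ ^ 2 / ‖r'‖ ^ 2 * ⟪r, Matrix.toEuclideanLin H p'⟫ := by positivity
  linarith [hHpos r]
end

section
/- In the quadratic FRGD setting, assume additionally that A is symmetric positive definite with smallest eigenvalue λmin and largest eigenvalue λmax, and set κ = λmax/λmin. Assume r_k ≠ 0 for 0 ≤ k ≤ n, set z_k = r_k/‖r_k‖, let Z_{n+1} = [z_0, …, z_n] (a d×(n+1) matrix) and Z_n = [z_0, …, z_{n−1}], and assume z_0, …, z_n are linearly independent, so that the pseudoinverse Z_{n+1}^+ = (Z_{n+1}ᵀ Z_{n+1})^{−1} Z_{n+1}ᵀ is defined. Let E be the (n+1)×n matrix whose top n×n block is the identity and whose last row is zero, and define K_n = ‖A·Z_n·T_n^{−1}·E·Z_{n+1}^+‖ (spectral norm). Then ‖r_n‖ ≤ 2·(1 + K_n)·((√κ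 − 1)/(√κ + 1))^n · ‖r_0‖. -/
open scoped RealInnerProductSpace

/-- `d × n` matrix whose `k`-th column is the vector `v k`. -/
noncomputable def colMat {d : ℕ} (n : ℕ) (v : ℕ → EuclideanSpace ℝ (Fin d)) :
    Matrix (Fin d) (Fin n) ℝ :=
  Matrix.of fun i k => v (k : ℕ) i

/-- The `n × n` lower bidiagonal matrix with `1` on the diagonal and `−1` on the
subdiagonal. -/
noncomputable def Lmat (n : ℕ) : Matrix (Fin n) (Fin n) ℝ :=
  Matrix.of fun i j => if (i : ℕ) = (j : ℕ) then 1
    else if (i : ℕ) = (j : ℕ) + 1 then -1 else 0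

/-- The `n × n` upper bidiagonal matrix with `1` on the diagonal and superdiagonal entries
`−β 1, …, −β (n−1)`. -/
noncomputable def Umat (n : ℕ) (β : ℕ → ℝ) : Matrix (Fin n) (Fin n) ℝ :=
  Matrix.of fun i j => if (i : ℕ) = (j : ℕ) then 1
    else if (j : ℕ) = (i : ℕ) + 1 then -β (j : ℕ) else 0

/-- The diagonal matrix `diag (‖r 0‖, …, ‖r (n−1)‖)`. -/
noncomputable def Dmat {d : ℕ} (n : ℕ) (r : ℕ → EuclideanSpace ℝ (Fin d)) :
    Matrix (Fin n) (Fin n) ℝ :=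
  Matrix.diagonal fun k => ‖r (k : ℕ)‖

/-- The Fletcher–Reeves momentum coefficient `β k = ‖r k‖² / ‖r (k−1)‖²`. -/
noncomputable def frBeta {d : ℕ} (r : ℕ → EuclideanSpace ℝ (Fin d)) (k : ℕ) : ℝ :=
  ‖r k‖ ^ 2 / ‖r (k - 1)‖ ^ 2

/-- The tridiagonal matrix `T_n = (1/α)·D_n·L_n·U_n·D_n⁻¹`. -/
noncomputable def Tmat {d : ℕ} (α : ℝ) (n : ℕ) (r : ℕ → EuclideanSpace ℝ (Fin d)) :
    Matrix (Fin n) (Fin n) ℝ :=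
  (1 / α) • (Dmat n r * Lmat n * Umat n (frBeta r) * (Dmat n r)⁻¹)

/-- The normalized residual `z k = r k / ‖r k‖`. -/
noncomputable def zvec {d : ℕ} (r : ℕ → EuclideanSpace ℝ (Fin d)) (k : ℕ) :
    EuclideanSpace ℝ (Fin d) :=
  ‖r k‖⁻¹ • r k

open scoped Matrix

/-- Shifted and rescaled Chebyshev polynomials are small on `[a, b]` and equal to `1` at `0`. -/
theorem exists_polynomial_abs_eval_le {a b : ℝ} (ha : 0 < a) (hab : a ≤ b) (n : ℕ) :
    ∃ q : Polynomial ℝ, q.natDegree ≤ n ∧ q.eval 0 = 1 ∧ ∀ t ∈ Set.Icc a b,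
      |q.eval t| ≤ 2 * ((Real.sqrt (b / a) - 1) / (Real.sqrt (b / a) + 1)) ^ n := by
  open Polynomial in
  rcases hab.eq_or_lt with rfl | hlt
  · refine ⟨(1 - C a⁻¹ * X) ^ n, ?_, by simp, ?_⟩
    · refine natDegree_pow_le.trans ?_
      have : (1 - C a⁻¹ * X : ℝ[X]).natDegree ≤ 1 := by compute_degree
      nlinarith
    · intro t ht
      obtain rfl : t = a := le_antisymm ht.2 ht.1
      have h : t⁻¹ * t = 1 := inv_mul_cancel₀ ha.ne'
      have h' : t / t = 1 := div_self ha.ne'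
      simp only [eval_pow, eval_sub, eval_one, eval_mul, eval_C, eval_X, h, h', Real.sqrt_one,
        sub_self, zero_div]
      rw [abs_of_nonneg (by positivity)]
      have : (0 : ℝ) ≤ 0 ^ n := by positivity
      linarith
  · set s := Real.sqrt (b / a) with hs
    have hss : s * s = b / a := Real.mul_self_sqrt (div_nonneg (ha.le.trans hab) ha.le)
    have hs1 : 1 < s := by
      rw [hs, Real.lt_sqrt (by norm_num), one_pow, one_lt_div ha]
      exact hlt
    have hb : b = s * s * a := by rw [hss]; field_simp
    set x := (s + 1) / (s - 1) with hx
    have hx0 : 0 < x := div_pos (by linarith) (by linarith)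
    have hsm : s - 1 ≠ 0 := by linarith
    have hsp : s + 1 ≠ 0 := by linarith
    have hcosh : Real.cosh (Real.log x) = (b + a) / (b - a) := by
      have hba' : b - a = (s - 1) * (s + 1) * a := by rw [hb]; ring
      rw [Real.cosh_log hx0, hx, hba', hb, inv_div]
      field_simp
      ring
    set c := (Chebyshev.T ℝ n).eval ((b + a) / (b - a)) with hc
    have hcx : x ^ n / 2 ≤ c := by
      rw [hc, ← hcosh, Chebyshev.T_real_cosh, Real.cosh_eq]
      have : Real.exp (((n : ℕ) : ℤ) * Real.log x) = x ^ n := by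
        rw [Int.cast_natCast, Real.exp_nat_mul, Real.exp_log hx0]
      rw [this]
      have := Real.exp_pos (-((((n : ℕ) : ℤ) : ℝ) * Real.log x))
      linarith
    have hxn : 0 < x ^ n := pow_pos hx0 n
    have hc0 : 0 < c := by linarith
    refine ⟨C c⁻¹ * (Chebyshev.T ℝ n).comp (C ((b + a) / (b - a)) - C (2 / (b - a)) * X),
      ?_, ?_, ?_⟩
    · refine (natDegree_C_mul_le _ _).trans (natDegree_comp_le.trans ?_)
      have h1 : (C ((b + a) / (b - a)) - C (2 / (b - a)) * X : ℝ[X]).natDegree ≤ 1 := by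
        compute_degree
      rw [Chebyshev.natDegree_T, Int.natAbs_natCast]
      nlinarith
    · simp [eval_comp, ← hc, hc0.ne']
    · intro t ht
      have hle : |(Chebyshev.T ℝ n).eval ((b + a) / (b - a) - 2 / (b - a) * t)| ≤ 1 := by
        apply Chebyshev.abs_eval_T_real_le_one
        have hpos : 0 < b - a := by linarith
        have : (b + a) / (b - a) - 2 / (b - a) * t = (b + a - 2 * t) / (b - a) := by
          field_simp
        rw [this, abs_div, abs_of_pos hpos, div_le_one hpos, abs_le]
        constructor <;> linarith [ht.1, ht.2]
      simp only [eval_mul, eval_C, eval_comp, eval_sub, eval_X]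
      rw [abs_mul, abs_of_pos (inv_pos.2 hc0)]
      have hρ : ((s - 1) / (s + 1)) ^ n = (x ^ n)⁻¹ := by rw [← inv_pow, hx, inv_div]
      rw [hρ]
      calc c⁻¹ * _ ≤ c⁻¹ * 1 := by gcongr
        _ ≤ (x ^ n / 2)⁻¹ * 1 := by gcongr
        _ = 2 * (x ^ n)⁻¹ := by rw [inv_div]; ring

theorem Matrix.IsHermitian.norm_aeval_toEuclideanLin_le {d : ℕ} {A : Matrix (Fin d) (Fin d) ℝ}
    (hA : A.IsHermitian) (q : Polynomial ℝ) {M : ℝ} (hM : ∀ μ ∈ spectrum ℝ A, |q.eval μ| ≤ M)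
    (v : EuclideanSpace ℝ (Fin d)) :
    ‖Polynomial.aeval (Matrix.toEuclideanLin A : Module.End ℝ (EuclideanSpace ℝ (Fin d))) q v‖
      ≤ M * ‖v‖ := by
  set f : Module.End ℝ (EuclideanSpace ℝ (Fin d)) := Matrix.toEuclideanLin A with hf
  set u := hA.eigenvectorBasis
  have hu (i) : Polynomial.aeval f q (u i) = q.eval (hA.eigenvalues i) • u i := by
    refine Module.End.aeval_apply_of_hasEigenvector ⟨?_, u.toBasis.ne_zero i⟩
    rw [Module.End.mem_eigenspace_iff]
    ext j
    have := congrFun (hA.mulVec_eigenvectorBasis i) j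
    simpa [hf] using this
  have hrepr : Polynomial.aeval f q v = ∑ i, (q.eval (hA.eigenvalues i) * u.repr v i) • u i := by
    conv_lhs => rw [← u.sum_repr v]
    rw [map_sum]
    refine Finset.sum_congr rfl fun i _ => ?_
    rw [map_smul, hu, smul_smul, mul_comm]
  have hcoord (i) : u.repr (Polynomial.aeval f q v) i
      = q.eval (hA.eigenvalues i) * u.repr v i := by
    rw [hrepr, ← u.coe_toBasis, ← u.coe_toBasis_repr_apply, u.toBasis.repr_sum_self]
  rcases isEmpty_or_nonempty (Fin d) with hd | ⟨⟨i₀⟩⟩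
  · simp [Subsingleton.elim v 0]
  have hM0 : 0 ≤ M := (abs_nonneg _).trans (hM _ (hA.eigenvalues_mem_spectrum_real i₀))
  refine le_of_sq_le_sq ?_ (by positivity)
  rw [mul_pow, ← u.repr.norm_map, ← u.repr.norm_map v, EuclideanSpace.norm_sq_eq,
    EuclideanSpace.norm_sq_eq, Finset.mul_sum]
  refine Finset.sum_le_sum fun i _ => ?_
  rw [hcoord, norm_mul, mul_pow]
  gcongr
  exact hM _ (hA.eigenvalues_mem_spectrum_real i)

theorem norm_toEuclideanLin_le_specNorm {m n : ℕ} (M : Matrix (Fin m) (Fin n) ℝ)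
    (v : EuclideanSpace ℝ (Fin n)) :
    ‖Matrix.toEuclideanLin M v‖ ≤ specNorm M * ‖v‖ :=
  (LinearMap.toContinuousLinearMap (Matrix.toEuclideanLin M)).le_opNorm v

section Krylov

variable {E : Type*} [AddCommGroup E] [Module ℝ E] {f : Module.End ℝ E} {r p : ℕ → E}
  {β : ℕ → ℝ} {α : ℝ}

/-- The span of the first `k` residuals. -/
def residualSpan (r : ℕ → E) (k : ℕ) : Submodule ℝ E := Submodule.span ℝ (r '' Set.Iio k)

theorem residualSpan_mono (r : ℕ → E) : Monotone (residualSpan r) := fun _ _ h =>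
  Submodule.span_mono (Set.image_mono (Set.Iio_subset_Iio h))

theorem mem_residualSpan (r : ℕ → E) {j k : ℕ} (h : j < k) : r j ∈ residualSpan r k :=
  Submodule.subset_span ⟨j, h, rfl⟩

theorem direction_mem_residualSpan (hp0 : p 0 = r 0)
    (hp : ∀ k, p (k + 1) = r (k + 1) + β k • p k) (k : ℕ) : p k ∈ residualSpan r (k + 1) := by
  induction k with
  | zero => rw [hp0]; exact mem_residualSpan r (by simp)
  | succ k ih =>
    rw [hp]
    exact add_mem (mem_residualSpan r (by simp))
      (Submodule.smul_mem _ _ (residualSpan_mono r (Nat.le_succ _) ih))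

theorem residualSpan_le_comap (hα : α ≠ 0) (hp0 : p 0 = r 0)
    (hp : ∀ k, p (k + 1) = r (k + 1) + β k • p k) (hr : ∀ k, r (k + 1) = r k - α • f (p k))
    (k : ℕ) : residualSpan r k ≤ (residualSpan r (k + 1)).comap f := by
  have hfp (j : ℕ) : f (p j) ∈ residualSpan r (j + 2) := by
    have : f (p j) = α⁻¹ • (r j - r (j + 1)) := by
      rw [hr j, sub_sub_cancel, smul_smul, inv_mul_cancel₀ hα, one_smul]
    rw [this]
    exact Submodule.smul_mem _ _
      (sub_mem (mem_residualSpan r (by omega)) (mem_residualSpan r (by omega)))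
  refine Submodule.span_le.2 ?_
  rintro _ ⟨j, hj, rfl⟩
  have hj : j < k := hj
  suffices h : f (r j) ∈ residualSpan r (j + 2) from
    residualSpan_mono r (show j + 2 ≤ k + 1 by omega) h
  cases j with
  | zero => rw [← hp0]; exact hfp 0
  | succ j =>
    rw [eq_sub_of_add_eq (hp j).symm, map_sub, map_smul]
    exact sub_mem (hfp _)
      (Submodule.smul_mem _ _ (residualSpan_mono r (by omega) (hfp j)))

theorem residual_sub_aeval_mem (hα : α ≠ 0) (hp0 : p 0 = r 0)
    (hp : ∀ k, p (k + 1) = r (k + 1) + β k • p k) (hr : ∀ k, r (k + 1) = r k - α • f (p k))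
    {n : ℕ} {q : Polynomial ℝ} (hq : q.natDegree ≤ n) (hq0 : q.eval 0 = 1) :
    r n - Polynomial.aeval f q (r 0) ∈ (residualSpan r n).map f := by
  have h1 : r n - r 0 ∈ (residualSpan r n).map f := by
    clear hq
    induction n with
    | zero => simp
    | succ n ih =>
      rw [hr n, sub_right_comm]
      exact sub_mem (Submodule.map_mono (residualSpan_mono r (Nat.le_succ n)) ih)
        (Submodule.smul_mem _ _
          (Submodule.mem_map_of_mem (direction_mem_residualSpan hp0 hp n)))
  have h2 (i : ℕ) : (f ^ i) (r 0) ∈ residualSpan r (i + 1) := by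
    induction i with
    | zero => exact mem_residualSpan r (by simp)
    | succ i ih =>
      rw [pow_succ', Module.End.mul_apply]
      exact residualSpan_le_comap hα hp0 hp hr _ ih
  have h3 : Polynomial.aeval f q (r 0) - r 0 ∈ (residualSpan r n).map f := by
    rw [Polynomial.aeval_eq_sum_range' (Nat.lt_succ_of_le hq), Finset.sum_range_succ',
      LinearMap.add_apply, LinearMap.sum_apply, Polynomial.coeff_zero_eq_eval_zero, hq0]
    simp only [pow_zero, one_smul, Module.End.one_apply, add_sub_cancel_right]
    refine sum_mem fun i hi => ?_
    rw [LinearMap.smul_apply, pow_succ', Module.End.mul_apply]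
    exact Submodule.smul_mem _ _ (Submodule.mem_map_of_mem
      (residualSpan_mono r (Finset.mem_range.1 hi) (h2 i)))
  have := sub_mem h1 h3
  rwa [sub_sub_sub_cancel_right] at this

end Krylov

theorem det_Lmat (n : ℕ) : (Lmat n).det = 1 := by
  rw [Matrix.det_of_isLowerTriangular]
  · simp [Lmat]
  · intro i j h
    have : i < j := h
    simp only [Lmat, Matrix.of_apply]
    rw [if_neg (by omega), if_neg (by omega)]

theorem det_Umat (n : ℕ) (β : ℕ → ℝ) : (Umat n β).det = 1 := by
  rw [Matrix.det_of_isUpperTriangular]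
  · simp [Umat]
  · intro i j h
    have : j < i := h
    simp only [Umat, Matrix.of_apply]
    rw [if_neg (by omega), if_neg (by omega)]

section Residuals

variable {d n : ℕ} {r p : ℕ → EuclideanSpace ℝ (Fin d)}

theorem isUnit_det_Dmat (hr : ∀ k < n, r k ≠ 0) : IsUnit (Dmat n r).det := by
  rw [Dmat, Matrix.det_diagonal, isUnit_iff_ne_zero, Finset.prod_ne_zero_iff]
  exact fun k _ => norm_ne_zero_iff.2 (hr k k.2)

theorem isUnit_det_Tmat {α : ℝ} (hα : α ≠ 0) (hr : ∀ k < n, r k ≠ 0) :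
    IsUnit (Tmat α n r).det := by
  have hD := isUnit_det_Dmat hr
  rw [Tmat, Matrix.det_smul, Matrix.det_mul, Matrix.det_mul, Matrix.det_mul, det_Lmat, det_Umat,
    mul_one, mul_one]
  exact ((isUnit_iff_ne_zero.2 (one_div_ne_zero hα)).pow _).mul
    (hD.mul (Matrix.isUnit_nonsing_inv_det _ hD))

theorem colMat_zvec_mul_Dmat (hr : ∀ k < n, r k ≠ 0) :
    colMat n (zvec r) * Dmat n r = colMat n r := by
  ext i k
  have : ‖r k‖ ≠ 0 := norm_ne_zero_iff.2 (hr k k.2)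
  simp [colMat, Dmat, zvec, Matrix.mul_diagonal]
  field_simp

theorem colMat_mul_Lmat (v : ℕ → EuclideanSpace ℝ (Fin d)) :
    colMat n v * Lmat n = colMat n (fun k => v k - v (k + 1)) +
      Matrix.vecMulVec (v n) (fun j : Fin n => if (j : ℕ) + 1 = n then 1 else 0) := by
  ext i j
  have key (k : ℕ) : v k i * (if k = (j : ℕ) then 1 else if k = (j : ℕ) + 1 then -1 else 0) =
      (if k = (j : ℕ) then v k i else 0) + (if k = (j : ℕ) + 1 then -v k i else 0) := by
    split_ifs <;> first | omega | simp
  simp only [Matrix.mul_apply, colMat, Lmat, Matrix.of_apply, key, Matrix.add_apply,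
    Matrix.vecMulVec_apply]
  rw [Fin.sum_univ_eq_sum_range (fun k => (if k = (j : ℕ) then v k i else 0) +
    (if k = (j : ℕ) + 1 then -v k i else 0)), Finset.sum_add_distrib,
    Finset.sum_ite_eq', Finset.sum_ite_eq', if_pos (Finset.mem_range.2 j.2)]
  by_cases h : (j : ℕ) + 1 = n
  · simp [h]
  · have : (j : ℕ) + 1 < n := by omega
    simp [h, this, sub_eq_add_neg]

theorem mul_Umat_apply {m : ℕ} (M : Matrix (Fin m) (Fin n) ℝ) (β : ℕ → ℝ) (i : Fin m)
    (j : Fin n) : (M * Umat n β) i j =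
      M i j - if h : 0 < (j : ℕ) then β j * M i ⟨j - 1, by omega⟩ else 0 := by
  have key (k : Fin n) : M i k * Umat n β k j = (if k = j then M i k else 0) +
      (if (j : ℕ) = k + 1 then -β j * M i k else 0) := by
    simp only [Umat, Matrix.of_apply, Fin.ext_iff]
    split_ifs <;> first | omega | simp [mul_comm]
  rw [Matrix.mul_apply]
  simp only [key]
  rw [Finset.sum_add_distrib, Finset.sum_ite_eq', if_pos (Finset.mem_univ _), sub_eq_add_neg]
  congr 1
  split_ifs with h
  · rw [Finset.sum_eq_single ⟨j - 1, by omega⟩]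
    · rw [if_pos (by simp; omega)]
      ring
    · intro k _ hk
      rw [if_neg]
      intro hjk
      exact hk (Fin.ext (by simp; omega))
    · simp
  · simp only [neg_zero]
    exact Finset.sum_eq_zero fun k _ => if_neg (by omega)

theorem colMat_mul_Umat {β : ℕ → ℝ} (hp0 : p 0 = r 0)
    (hp : ∀ k, p (k + 1) = r (k + 1) + β (k + 1) • p k) :
    colMat n p * Umat n β = colMat n r := by
  ext i ⟨j, hj⟩
  rw [mul_Umat_apply]
  cases j with
  | zero => simp [colMat, hp0]
  | succ j => simp [colMat, hp]

theorem vecMulVec_last_mul_Umat {m : ℕ} (v : Fin m → ℝ) (β : ℕ → ℝ) :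
    Matrix.vecMulVec v (fun j : Fin n => if (j : ℕ) + 1 = n then (1 : ℝ) else 0) * Umat n β =
      Matrix.vecMulVec v (fun j : Fin n => if (j : ℕ) + 1 = n then 1 else 0) := by
  ext i j
  rw [mul_Umat_apply]
  simp only [Matrix.vecMulVec_apply]
  have : (j : ℕ) - 1 + 1 ≠ n ∨ ¬ 0 < (j : ℕ) := by omega
  rcases this with h | h <;> simp [h]

/-- The perturbed Lanczos-type recurrence satisfied by the normalized residuals. -/
theorem exists_mul_colMat_zvec_eq {A : Matrix (Fin d) (Fin d) ℝ} {α : ℝ} (hα : α ≠ 0)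
    (hp0 : p 0 = r 0) (hp : ∀ k, p (k + 1) = r (k + 1) + frBeta r (k + 1) • p k)
    (hr : ∀ k, r (k + 1) = r k - α • Matrix.toEuclideanLin A (p k)) (hr0 : ∀ k ≤ n, r k ≠ 0) :
    ∃ u : Fin n → ℝ, A * colMat n (zvec r) =
      colMat n (zvec r) * Tmat α n r + Matrix.vecMulVec (zvec r n) u := by
  have hD := isUnit_det_Dmat fun k (hk : k < n) => hr0 k hk.le
  set e : Fin n → ℝ := fun j => if (j : ℕ) + 1 = n then 1 else 0 with he
  have hZ : colMat n (zvec r) = colMat n r * (Dmat n r)⁻¹ := by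
    rw [← colMat_zvec_mul_Dmat fun k hk => hr0 k hk.le, Matrix.mul_assoc,
      Matrix.mul_nonsing_inv _ hD, Matrix.mul_one]
  have hAP : A * colMat n p =
      (1 / α) • (colMat n r * Lmat n - Matrix.vecMulVec (r n) e) := by
    rw [colMat_mul_Lmat, add_sub_cancel_right]
    ext i k
    have := congrArg (fun v => v i) (hr k)
    simp only [PiLp.sub_apply, PiLp.smul_apply, Matrix.ofLp_toLpLin, Matrix.toLin'_apply] at this
    simp only [Matrix.smul_apply, colMat, Matrix.of_apply, PiLp.sub_apply, this, smul_eq_mul,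
      Matrix.mul_apply, Matrix.mulVec, dotProduct]
    field_simp
    ring
  refine ⟨-((1 / α) • ‖r n‖ • (e ᵥ* (Dmat n r)⁻¹)), ?_⟩
  have hrn : (r n : Fin d → ℝ) = ‖r n‖ • (zvec r n : Fin d → ℝ) := by
    have : ‖r n‖ ≠ 0 := norm_ne_zero_iff.2 (hr0 n le_rfl)
    ext i
    simp [zvec, this]
  have hAR : A * colMat n r =
      (1 / α) • (colMat n r * Lmat n * Umat n (frBeta r) - Matrix.vecMulVec (r n) e) := by
    conv_lhs => rw [← colMat_mul_Umat hp0 hp]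
    rw [← Matrix.mul_assoc, hAP, Matrix.smul_mul, Matrix.sub_mul, vecMulVec_last_mul_Umat]
  calc A * colMat n (zvec r)
      = A * colMat n r * (Dmat n r)⁻¹ := by rw [hZ, Matrix.mul_assoc]
    _ = (1 / α) • (colMat n r * Lmat n * Umat n (frBeta r) * (Dmat n r)⁻¹) -
          (1 / α) • Matrix.vecMulVec (r n) (e ᵥ* (Dmat n r)⁻¹) := by
        rw [hAR, Matrix.smul_mul, Matrix.sub_mul, smul_sub, Matrix.vecMulVec_mul]
    _ = _ := by
        rw [sub_eq_add_neg]
        congr 1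
        · rw [Tmat, Matrix.mul_smul, ← colMat_zvec_mul_Dmat fun k hk => hr0 k hk.le]
          simp only [Matrix.mul_assoc]
        · rw [hrn]
          ext i j
          simp only [Matrix.neg_apply, Matrix.smul_apply, Matrix.vecMulVec_apply, Pi.smul_apply,
            Pi.neg_apply, smul_eq_mul]
          ring

end Residuals

/-- The `(n + 1) × n` matrix with identity top block and zero last row. -/
def topIdentity (n : ℕ) : Matrix (Fin (n + 1)) (Fin n) ℝ :=
  Matrix.of fun i j => if (i : ℕ) = (j : ℕ) then 1 else 0

theorem topIdentity_transpose_mul_self (n : ℕ) :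
    (topIdentity n).transpose * topIdentity n = 1 := by
  ext i j
  rw [Matrix.mul_apply, Fin.sum_univ_castSucc]
  have : n ≠ i := by omega
  simp [topIdentity, this, Matrix.one_apply, ← Fin.ext_iff, eq_comm]

theorem topIdentity_transpose_mulVec_single_last (n : ℕ) (c : ℝ) :
    (topIdentity n).transpose *ᵥ Pi.single (Fin.last n) c = 0 := by
  ext i
  have : n ≠ i := by omega
  simp [topIdentity, this]

theorem colMat_succ_mul_topIdentity {d : ℕ} (n : ℕ) (v : ℕ → EuclideanSpace ℝ (Fin d)) :
    colMat (n + 1) v * topIdentity n = colMat n v := by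
  ext i j
  rw [Matrix.mul_apply, Fin.sum_univ_castSucc]
  have : n ≠ j := by omega
  simp [topIdentity, this, colMat, ← Fin.ext_iff]

theorem colMat_mulVec_single {d : ℕ} {n : ℕ} (v : ℕ → EuclideanSpace ℝ (Fin d)) (k : Fin n)
    (c : ℝ) : colMat n v *ᵥ Pi.single k c = c • (v k : Fin d → ℝ) := by
  ext i
  simp [colMat, mul_comm]

theorem isUnit_det_colMat_gram {d n : ℕ} {v : ℕ → EuclideanSpace ℝ (Fin d)}
    (hv : LinearIndependent ℝ fun k : Fin n => v k) :
    IsUnit ((colMat n v).transpose * colMat n v).det := by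
  have hinj : Function.Injective (colMat n v).mulVec := by
    rw [Matrix.mulVec_injective_iff]
    exact hv.map' (WithLp.linearEquiv 2 ℝ (Fin d → ℝ)).toLinearMap (LinearEquiv.ker _)
  have := Matrix.PosDef.conjTranspose_mul_self (colMat n v) hinj
  rw [Matrix.conjTranspose_eq_transpose_of_trivial] at this
  exact this.det_pos.ne'.isUnit

/-- in the quadratic FRGD setting with `A` symmetric positive definite with
smallest eigenvalue `λmin` and largest eigenvalue `λmax`, `κ = λmax/λmin`, and with
`z_0, …, z_n` linearly independent, one has
`‖r n‖ ≤ 2·(1 + K_n)·((√κ − 1)/(√κ + 1))^n·‖r 0‖`, where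
`K_n = ‖A·Z_n·T_n⁻¹·[I_n; 0]ᵀ·Z_{n+1}⁺‖` and `Z_{n+1}⁺ = (Z_{n+1}ᵀ Z_{n+1})⁻¹ Z_{n+1}ᵀ`. -/
theorem quad_frgd_convergence {d : ℕ} (A : Matrix (Fin d) (Fin d) ℝ)
    (b : EuclideanSpace ℝ (Fin d)) (α : ℝ) (hα : 0 < α)
    (w r p : ℕ → EuclideanSpace ℝ (Fin d))
    (hr : ∀ k, r k = Matrix.toEuclideanLin A (w k) - b)
    (hp0 : p 0 = r 0)
    (hp : ∀ k, 1 ≤ k → p k = r k + frBeta r k • p (k - 1))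
    (hw : ∀ k, w (k + 1) = w k - α • p k)
    (hA : A.PosDef) (lmin lmax : ℝ)
    (hlmin : lmin ∈ spectrum ℝ A) (hlmax : lmax ∈ spectrum ℝ A)
    (hmin : ∀ μ ∈ spectrum ℝ A, lmin ≤ μ) (hmax : ∀ μ ∈ spectrum ℝ A, μ ≤ lmax)
    (n : ℕ) (hrnz : ∀ k ≤ n, r k ≠ 0)
    (hli : LinearIndependent ℝ (fun k : Fin (n + 1) => zvec r (k : ℕ))) :
    ‖r n‖ ≤
      2 * (1 + specNorm (A * colMat n (zvec r) * (Tmat α n r)⁻¹ *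
            (Matrix.of fun (i : Fin (n + 1)) (j : Fin n) =>
              if (i : ℕ) = (j : ℕ) then (1 : ℝ) else 0).transpose *
            (((colMat (n + 1) (zvec r)).transpose * colMat (n + 1) (zvec r))⁻¹ *
              (colMat (n + 1) (zvec r)).transpose))) *
        ((Real.sqrt (lmax / lmin) - 1) / (Real.sqrt (lmax / lmin) + 1)) ^ n * ‖r 0‖ := by
  have hα0 := hα.ne'
  set f : Module.End ℝ (EuclideanSpace ℝ (Fin d)) := Matrix.toEuclideanLin A with hf
  have hp' (k : ℕ) : p (k + 1) = r (k + 1) + frBeta r (k + 1) • p k := hp (k + 1) (by omega)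
  have hr' (k : ℕ) : r (k + 1) = r k - α • f (p k) := by
    rw [hr, hw, map_sub, map_smul, hr k]
    abel
  have hlmin0 : 0 < lmin := by
    rw [hA.1.spectrum_real_eq_range_eigenvalues] at hlmin
    obtain ⟨i, rfl⟩ := hlmin
    exact hA.eigenvalues_pos i
  obtain ⟨q, hqdeg, hq0, hq⟩ := exists_polynomial_abs_eval_le hlmin0 (hmin lmax hlmax) n
  obtain ⟨u, hu⟩ := exists_mul_colMat_zvec_eq hα0 hp0 hp' hr' hrnz
  have hT := isUnit_det_Tmat (α := α) hα0 fun k (hk : k < n) => hrnz k hk.le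
  have hG := isUnit_det_colMat_gram hli
  change ‖r n‖ ≤ 2 * (1 + specNorm (A * colMat n (zvec r) * (Tmat α n r)⁻¹ *
    (topIdentity n).transpose * _)) * _ * _
  set Z := colMat (n + 1) (zvec r) with hZ
  set B := A * colMat n (zvec r) * (Tmat α n r)⁻¹ * (topIdentity n).transpose *
    ((Z.transpose * Z)⁻¹ * Z.transpose) with hB
  have hBZ : B * Z = A * colMat n (zvec r) * (Tmat α n r)⁻¹ * (topIdentity n).transpose := by
    rw [hB, Matrix.mul_assoc, Matrix.mul_assoc _ Z.transpose, Matrix.nonsing_inv_mul _ hG,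
      Matrix.mul_one]
  have hzn : (zvec r n : Fin d → ℝ) = Z *ᵥ Pi.single (Fin.last n) 1 := by
    rw [hZ, colMat_mulVec_single, one_smul, Fin.val_last]
  have hBzn : B *ᵥ (zvec r n : Fin d → ℝ) = 0 := by
    rw [hzn, Matrix.mulVec_mulVec, hBZ, ← Matrix.mulVec_mulVec,
      topIdentity_transpose_mulVec_single_last, Matrix.mulVec_zero]
  have hBA : B * (A * colMat n (zvec r)) = A * colMat n (zvec r) := by
    conv_lhs => rw [hu]
    rw [Matrix.mul_add, Matrix.mul_vecMulVec, hBzn, Matrix.zero_vecMulVec, add_zero,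
      ← colMat_succ_mul_topIdentity n (zvec r), ← hZ, ← Matrix.mul_assoc, ← Matrix.mul_assoc, hBZ,
      Matrix.mul_assoc _ _ (topIdentity n), topIdentity_transpose_mul_self, Matrix.mul_one,
      Matrix.mul_assoc _ _ (Tmat α n r), Matrix.nonsing_inv_mul _ hT, Matrix.mul_one,
      colMat_succ_mul_topIdentity]
  have hrz (k : ℕ) (hk : k ≤ n) : r k = ‖r k‖ • zvec r k := by
    rw [zvec, smul_smul, mul_inv_cancel₀ (norm_ne_zero_iff.2 (hrnz k hk)), one_smul]
  have hBrn : Matrix.toEuclideanLin B (r n) = 0 := by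
    rw [hrz n le_rfl, map_smul, Matrix.toLpLin_apply, hBzn, WithLp.toLp_zero, smul_zero]
  have hfix : (residualSpan r n).map f ≤
      LinearMap.ker (LinearMap.id - Matrix.toEuclideanLin B) := by
    rw [residualSpan, Submodule.map_span_le]
    rintro _ ⟨k, hk, rfl⟩
    have hk : k < n := hk
    rw [LinearMap.mem_ker, LinearMap.sub_apply, LinearMap.id_apply, sub_eq_zero, hrz k hk.le,
      map_smul, map_smul]
    congr 1
    have := congrArg (· *ᵥ Pi.single (⟨k, hk⟩ : Fin n) (1 : ℝ)) hBA
    simp only [← Matrix.mulVec_mulVec, colMat_mulVec_single, one_smul] at this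
    rw [hf, Matrix.toLpLin_apply, Matrix.toLpLin_apply, this]
  set v := Polynomial.aeval f q (r 0)
  have hrv : r n = v - Matrix.toEuclideanLin B v := by
    have h := hfix (residual_sub_aeval_mem hα0 hp0 (β := fun k => frBeta r (k + 1))
      hp' hr' hqdeg hq0)
    rw [LinearMap.mem_ker, LinearMap.sub_apply, LinearMap.id_apply, map_sub, hBrn, zero_sub,
      sub_neg_eq_add] at h
    rw [← sub_eq_zero, ← h]
    abel
  have hv : ‖v‖ ≤ 2 * ((√(lmax / lmin) - 1) / (√(lmax / lmin) + 1)) ^ n * ‖r 0‖ :=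
    hA.1.norm_aeval_toEuclideanLin_le q (fun μ hμ => hq μ ⟨hmin μ hμ, hmax μ hμ⟩) (r 0)
  have hB0 : 0 ≤ specNorm B := norm_nonneg _
  calc ‖r n‖ ≤ ‖v‖ + ‖Matrix.toEuclideanLin B v‖ := by rw [hrv]; exact norm_sub_le _ _
    _ ≤ ‖v‖ + specNorm B * ‖v‖ := by gcongr; exact norm_toEuclideanLin_le_specNorm B v
    _ = (1 + specNorm B) * ‖v‖ := by ring
    _ ≤ (1 + specNorm B) *
        (2 * ((√(lmax / lmin) - 1) / (√(lmax / lmin) + 1)) ^ n * ‖r 0‖) := by gcongr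
    _ = _ := by ring
end
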